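/- For every complex number z with |z| < 4/27, the function G(z) = Σ_{n≥0} C(3n,n)·(2/(n+1)) · zⁿ satisfies the algebraic equation 2 − z − (1+2z)·G(z) + 2z·G(z)² − z²·G(z)³ = 0. -/

import Mathlib

/-- The generating function of the numbers `C(3n,n)·2/(n+1)`. -/
noncomputable def G (z : ℂ) : ℂ :=
  ∑' n : ℕ, (Nat.choose (3 * n) n : ℂ) * (2 / (n + 1)) * z ^ n

open PowerSeries in
theorem exT : ∃ T : PowerSeries ℂ, T = 1 + X * T ^ 3 := by
  let S : ℕ → PowerSeries ℂ := fun k => Nat.rec 1 (fun _ f => 1 + X * f ^ 3) k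
  have hS : ∀ k, S (k + 1) = 1 + X * S k ^ 3 := fun k => rfl
  have h1 : ∀ k, (X : PowerSeries ℂ) ^ (k + 1) ∣ S (k + 1) - S k := by
    intro k
    induction k with
    | zero => rw [hS]; exact ⟨1, by simp [S]⟩
    | succ k ih =>
      obtain ⟨c, hc⟩ := ih
      refine ⟨c * (S (k + 1) ^ 2 + S (k + 1) * S k + S k ^ 2), ?_⟩
      rw [hS (k + 1)]
      nth_rewrite 2 [hS k]
      linear_combination X * (S (k + 1) ^ 2 + S (k + 1) * S k + S k ^ 2) * hc
  have h2 : ∀ k j, (X : PowerSeries ℂ) ^ (k + 1) ∣ S (k + j) - S k := by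
    intro k j
    induction j with
    | zero => simp
    | succ j ih =>
      have h3 := (pow_dvd_pow (X : PowerSeries ℂ) (show k + 1 ≤ k + j + 1 by omega)).trans (h1 (k + j))
      have := dvd_add h3 ih
      rw [← add_assoc]
      simpa using this
  let T : PowerSeries ℂ := PowerSeries.mk fun n => coeff n (S n)
  have h3 : ∀ k, (X : PowerSeries ℂ) ^ (k + 1) ∣ T - S k := by
    intro k
    rw [X_pow_dvd_iff]
    intro m hm
    have h4 := h2 m (k - m)
    rw [X_pow_dvd_iff] at h4
    have h5 := h4 m (by omega)
    rw [show m + (k - m) = k by omega, map_sub] at h5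
    rw [map_sub, coeff_mk]
    linear_combination -h5
  refine ⟨T, ?_⟩
  rw [← sub_eq_zero]
  ext n
  have h4 : (X : PowerSeries ℂ) ^ (n + 1) ∣ T - (1 + X * T ^ 3) := by
    obtain ⟨c, hc⟩ := (pow_dvd_pow (X : PowerSeries ℂ) (show n + 1 ≤ n + 1 + 1 by omega)).trans (h3 (n + 1))
    obtain ⟨e, he⟩ := h3 n
    refine ⟨c - X * e * (T ^ 2 + T * S n + S n ^ 2), ?_⟩
    rw [hS] at hc
    linear_combination hc - X * (T ^ 2 + T * S n + S n ^ 2) * he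
  rw [X_pow_dvd_iff] at h4
  simpa using h4 n (by omega)

theorem choose_rec (n : ℕ) : (Nat.choose (3 * (n + 1)) (n + 1) : ℂ) * (2 * (n + 1) * (2 * n + 1)) =
    3 * (3 * n + 2) * (3 * n + 1) * Nat.choose (3 * n) n := by
  have h1 := Nat.choose_mul_factorial_mul_factorial (show n ≤ 3 * n by omega)
  have h2 := Nat.choose_mul_factorial_mul_factorial (show n + 1 ≤ 3 * (n + 1) by omega)
  rw [show 3 * n - n = 2 * n by omega] at h1
  rw [show 3 * (n + 1) - (n + 1) = 2 * n + 1 + 1 by omega] at h2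
  rw [show (3 * (n + 1)).factorial = (3 * n + 1 + 1 + 1).factorial from rfl] at h2
  simp only [Nat.factorial_succ] at h2
  rw [← h1] at h2
  have h3 := congrArg (Nat.cast : ℕ → ℂ) h2
  push_cast at h3
  have f1 : (n.factorial : ℂ) ≠ 0 := by exact_mod_cast n.factorial_ne_zero
  have f2 : ((2 * n).factorial : ℂ) ≠ 0 := by exact_mod_cast (2 * n).factorial_ne_zero
  have f3 : (n : ℂ) + 1 ≠ 0 := by exact_mod_cast n.succ_ne_zero
  apply mul_left_cancel₀ (mul_ne_zero (mul_ne_zero f1 f2) f3)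
  linear_combination h3

noncomputable def ac (n : ℕ) : ℂ := (Nat.choose (3 * n) n : ℂ) * (2 / (n + 1))

theorem ac_rec (n : ℕ) : 2 * ((n : ℂ) + 2) * (2 * n + 1) * ac (n + 1) =
    3 * (3 * n + 2) * (3 * n + 1) * ac n := by
  have f3 : (n : ℂ) + 1 ≠ 0 := by exact_mod_cast n.succ_ne_zero
  have f4 : (n : ℂ) + 2 ≠ 0 := by exact_mod_cast (n + 1).succ_ne_zero
  have f5 : (n : ℂ) + 1 + 1 ≠ 0 := by exact_mod_cast (n + 1).succ_ne_zero
  have h := choose_rec n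
  unfold ac
  push_cast
  field_simp
  linear_combination ((n : ℂ) + 2) * h

open PowerSeries in
theorem formal : ∃ T : PowerSeries ℂ, T = 1 + X * T ^ 3 ∧ PowerSeries.mk ac = T + T ^ 2 := by
  obtain ⟨T, hT⟩ := exT
  refine ⟨T, hT, ?_⟩
  let th : PowerSeries ℂ → PowerSeries ℂ := fun f => X * d⁄dX ℂ f
  have th_def : ∀ f, th f = X * d⁄dX ℂ f := fun _ => rfl
  have thadd : ∀ f g, th (f + g) = th f + th g := by intro f g; simp [th]; ring
  have thmul : ∀ f g, th (f * g) = f * th g + g * th f := by intro f g; simp [th]; ring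
  have thcoeff : ∀ f n, coeff n (th f) = n * coeff n f := by
    intro f n
    cases n with
    | zero => simp [th]
    | succ n => simp [th, coeff_succ_X_mul, coeff_derivative]; ring
  have thX : th X = X := by simp [th]
  have th1 : th 1 = 0 := by simp [th]
  have c0 : constantCoeff T = 1 := by rw [hT]; simp
  have T0 : T ≠ 0 := by rintro h; simp [h] at c0
  have V0 : (3 - 2 * T) ≠ 0 := by
    intro h
    have := congrArg constantCoeff h
    simp only [map_sub, map_mul, c0, map_zero, map_ofNat] at this
    norm_num at this
  obtain ⟨Y, hY⟩ : ∃ Y, Y = th T := ⟨_, rfl⟩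
  obtain ⟨Z, hZ⟩ : ∃ Z, Z = th Y := ⟨_, rfl⟩
  have e1 : (3 - 2 * T) * Y = T * (T - 1) := by
    have := congrArg th hT
    simp only [pow_succ, pow_zero, one_mul, thadd, thmul, th1, thX, ← hY] at this
    linear_combination T * this + (T + 3 * Y) * (-hT)
  have e2 : (3 - 2 * T) * Z = 2 * Y ^ 2 + (2 * T - 1) * Y := by
    have e1' : 3 * Y + T = 2 * (T * Y) + T * T := by linear_combination e1
    have k2 : ∀ f, th (2 * f) = 2 * th f := by
      intro f; rw [two_mul, thadd]; ring
    have k3 : ∀ f, th (3 * f) = 3 * th f := by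
      intro f; rw [show 3 * f = f + f + f by ring, thadd, thadd]; ring
    have := congrArg th e1'
    simp only [thadd, k2, k3, thmul, ← hY, ← hZ] at this
    linear_combination this
  have a1 : th (T + T ^ 2) = (1 + 2 * T) * Y := by
    rw [pow_two, thadd, thmul, ← hY]; ring
  have a2 : th (th (T + T ^ 2)) = (1 + 2 * T) * Z + 2 * Y ^ 2 := by
    rw [a1, show (1 + 2 * T) * Y = Y + (T * Y + T * Y) by ring]
    simp only [thadd, thmul, ← hY, ← hZ]; ring
  have b2 : (3 - 2 * T) ^ 2 * Y ^ 2 = T ^ 2 * (T - 1) ^ 2 := by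
    rw [← mul_pow, e1]; ring
  have b3 : (3 - 2 * T) ^ 3 * Z = 2 * (T ^ 2 * (T - 1) ^ 2) + (2 * T - 1) * (3 - 2 * T) * (T * (T - 1)) := by
    linear_combination (3 - 2 * T) ^ 2 * e2 + 2 * b2 + (2 * T - 1) * (3 - 2 * T) * e1
  obtain ⟨F, hF⟩ : ∃ F, F = T + T ^ 2 := ⟨_, rfl⟩
  rw [← hF] at a1 a2 ⊢
  have ode : 4 * th (th F) + 2 * th F - 2 * F + 4 = X * (27 * th (th F) + 27 * th F + 6 * F) := by
    rw [a2, a1, hF]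
    apply mul_left_cancel₀ (mul_ne_zero (pow_ne_zero 3 T0) (pow_ne_zero 3 V0))
    linear_combination (3 - 2 * T) ^ 3 * (27 * ((1 + 2 * T) * Z + 2 * Y ^ 2) + 27 * ((1 + 2 * T) * Y) + 6 * (T + T ^ 2)) * hT
      + (1 + 2 * T) * (4 * T ^ 3 - 27 * (T - 1)) * b3
      + 2 * (4 * T ^ 3 - 27 * (T - 1)) * (3 - 2 * T) * b2
      + (1 + 2 * T) * (2 * T ^ 3 - 27 * (T - 1)) * (3 - 2 * T) ^ 2 * e1
  ext n
  rw [coeff_mk]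
  induction n with
  | zero => simp [ac, hF, c0]; norm_num
  | succ n ih =>
    have h := congrArg (coeff (n + 1)) ode
    rw [coeff_succ_X_mul] at h
    have n2 : (2 : PowerSeries ℂ) = C 2 := (map_ofNat C 2).symm
    have n4 : (4 : PowerSeries ℂ) = C 4 := (map_ofNat C 4).symm
    have n6 : (6 : PowerSeries ℂ) = C 6 := (map_ofNat C 6).symm
    have n27 : (27 : PowerSeries ℂ) = C 27 := (map_ofNat C 27).symm
    rw [n2, n4, n6, n27] at h
    simp only [map_add, map_sub, coeff_C_mul, thcoeff, coeff_C, ← ih] at h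
    simp only [Nat.add_eq_zero_iff, one_ne_zero, and_false, if_false] at h
    push_cast at h
    have r := ac_rec n
    have f1 : 2 * ((n : ℂ) + 2) * (2 * n + 1) ≠ 0 := by
      refine mul_ne_zero (mul_ne_zero two_ne_zero ?_) ?_
      · exact_mod_cast (n + 1).succ_ne_zero
      · exact_mod_cast (2 * n).succ_ne_zero
    apply mul_left_cancel₀ f1
    linear_combination r - h

theorem ac_summable (z : ℂ) (hz : ‖z‖ < 4 / 27) : Summable fun n => ‖ac n * z ^ n‖ := by
  by_cases h0 : z = 0
  · apply summable_of_ne_finset_zero (s := {0})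
    intro n hn
    simp at hn
    simp [h0, hn]
  have acne : ∀ n, ac n ≠ 0 := by
    intro n
    have f3 : (n : ℂ) + 1 ≠ 0 := by exact_mod_cast n.succ_ne_zero
    have : (Nat.choose (3 * n) n : ℂ) ≠ 0 := by
      exact_mod_cast (Nat.choose_pos (show n ≤ 3 * n by omega)).ne'
    unfold ac
    exact mul_ne_zero this (div_ne_zero two_ne_zero f3)
  have hr : ∀ n : ℕ, ‖ac (n + 1) * z ^ (n + 1)‖ / ‖ac n * z ^ n‖ ≤ 27 / 4 * ‖z‖ := by
    intro n
    have r := congrArg norm (ac_rec n)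
    have q1 : ‖2 * ((n : ℂ) + 2) * (2 * n + 1)‖ = 2 * ((n : ℝ) + 2) * (2 * n + 1) := by
      have : 2 * ((n : ℂ) + 2) * (2 * n + 1) = ((2 * (n + 2) * (2 * n + 1) : ℕ) : ℂ) := by push_cast; ring
      rw [this, Complex.norm_natCast]; push_cast; ring
    have q2 : ‖3 * (3 * (n : ℂ) + 2) * (3 * n + 1)‖ = 3 * (3 * (n : ℝ) + 2) * (3 * n + 1) := by
      have : 3 * (3 * (n : ℂ) + 2) * (3 * n + 1) = ((3 * (3 * n + 2) * (3 * n + 1) : ℕ) : ℂ) := by push_cast; ring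
      rw [this, Complex.norm_natCast]; push_cast; ring
    rw [norm_mul, norm_mul _ (ac n), q1, q2] at r
    have p0 : 0 < ‖ac n‖ := norm_pos_iff.2 (acne n)
    have pz : 0 < ‖z‖ := norm_pos_iff.2 h0
    have key : ‖ac (n + 1)‖ ≤ 27 / 4 * ‖ac n‖ := by
      have hn : (0 : ℝ) ≤ n := n.cast_nonneg
      have pp : (0 : ℝ) < 2 * ((n : ℝ) + 2) * (2 * n + 1) := by positivity
      apply le_of_mul_le_mul_left _ pp
      rw [r]
      have : 3 * (3 * (n : ℝ) + 2) * (3 * n + 1) ≤ 2 * ((n : ℝ) + 2) * (2 * n + 1) * (27 / 4) := by nlinarith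
      nlinarith
    rw [div_le_iff₀ (norm_pos_iff.2 (mul_ne_zero (acne n) (pow_ne_zero n h0)))]
    rw [norm_mul, norm_mul, pow_succ, norm_mul]
    calc ‖ac (n + 1)‖ * (‖z ^ n‖ * ‖z‖) ≤ (27 / 4 * ‖ac n‖) * (‖z ^ n‖ * ‖z‖) := by gcongr
      _ = _ := by ring
  apply summable_of_ratio_norm_eventually_le (r := 27 / 4 * ‖z‖) (by linarith)
  filter_upwards with n
  have := hr n
  rw [div_le_iff₀ (norm_pos_iff.2 (mul_ne_zero (acne n) (pow_ne_zero n h0)))] at this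
  simpa only [norm_norm] using this

/-- evaluation predicate for power series -/
def HasE (z : ℂ) (f : PowerSeries ℂ) (v : ℂ) : Prop :=
  (Summable fun n => ‖PowerSeries.coeff n f * z ^ n‖) ∧ ∑' n, PowerSeries.coeff n f * z ^ n = v

theorem HasE.add {z : ℂ} {f g : PowerSeries ℂ} {v w : ℂ} (hf : HasE z f v) (hg : HasE z g w) :
    HasE z (f + g) (v + w) := by
  have e : ∀ n, PowerSeries.coeff n (f + g) * z ^ n
      = PowerSeries.coeff n f * z ^ n + PowerSeries.coeff n g * z ^ n := by
    intro n; rw [map_add]; ring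
  refine ⟨?_, ?_⟩
  · simp only [e]
    exact (hf.1.add hg.1).of_nonneg_of_le (fun _ => norm_nonneg _) (fun _ => norm_add_le _ _)
  · simp only [e]
    rw [hf.1.of_norm.tsum_add hg.1.of_norm, hf.2, hg.2]

theorem HasE.mul {z : ℂ} {f g : PowerSeries ℂ} {v w : ℂ} (hf : HasE z f v) (hg : HasE z g w) :
    HasE z (f * g) (v * w) := by
  have e : ∀ n, PowerSeries.coeff n (f * g) * z ^ n
      = ∑ kl ∈ Finset.HasAntidiagonal.antidiagonal n, (PowerSeries.coeff kl.1 f * z ^ kl.1) *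
        (PowerSeries.coeff kl.2 g * z ^ kl.2) := by
    intro n
    rw [PowerSeries.coeff_mul, Finset.sum_mul]
    refine Finset.sum_congr rfl fun kl h => ?_
    rw [← Finset.HasAntidiagonal.mem_antidiagonal.1 h, pow_add]; ring
  refine ⟨?_, ?_⟩
  · simp only [e]
    have h := summable_norm_sum_mul_antidiagonal_of_summable_norm
      (f := fun n => PowerSeries.coeff n f * z ^ n) (g := fun n => PowerSeries.coeff n g * z ^ n) hf.1 hg.1
    exact h
  · simp only [e]
    have h := tsum_mul_tsum_eq_tsum_sum_antidiagonal_of_summable_norm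
      (f := fun n => PowerSeries.coeff n f * z ^ n) (g := fun n => PowerSeries.coeff n g * z ^ n) hf.1 hg.1
    rw [← h, hf.2, hg.2]

theorem HasE.const (z c : ℂ) : HasE z (PowerSeries.C c) c := by
  have e : ∀ n, n ≠ 0 → PowerSeries.coeff n (PowerSeries.C c) * z ^ n = 0 := by
    intro n hn; simp [PowerSeries.coeff_C, hn]
  refine ⟨summable_of_ne_finset_zero (s := {0}) ?_, ?_⟩
  · intro n hn; rw [e n (by simpa using hn), norm_zero]
  · rw [tsum_eq_single 0 e]; simp

theorem HasE.X (z : ℂ) : HasE z PowerSeries.X z := by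
  have e : ∀ n, n ≠ 1 → PowerSeries.coeff n (PowerSeries.X : PowerSeries ℂ) * z ^ n = 0 := by
    intro n hn; simp [PowerSeries.coeff_X, hn]
  refine ⟨summable_of_ne_finset_zero (s := {1}) ?_, ?_⟩
  · intro n hn; rw [e n (by simpa using hn), norm_zero]
  · rw [tsum_eq_single 1 e]; simp

theorem stmt_4 (z : ℂ) (hz : ‖z‖ < 4 / 27) :
    2 - z - (1 + 2 * z) * G z + 2 * z * (G z) ^ 2 - z ^ 2 * (G z) ^ 3 = 0 := by
  obtain ⟨T, hT, hF⟩ := formal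
  have hG : HasE z (PowerSeries.mk ac) (G z) := by
    refine ⟨by simpa using ac_summable z hz, ?_⟩
    simp [G, ac]
  obtain ⟨F, hFF⟩ : ∃ F, F = PowerSeries.mk ac := ⟨_, rfl⟩
  rw [← hFF] at hF hG
  have hX := HasE.X z
  have hL := (HasE.const z 2).add ((HasE.const z 2).mul (hX.mul (hG.mul hG)))
  have hR := ((hX.add hG).add ((HasE.const z 2).mul (hX.mul hG))).add
    ((hX.mul hX).mul (hG.mul (hG.mul hG)))
  have key : PowerSeries.C (2 : ℂ) + PowerSeries.C (2 : ℂ) * (PowerSeries.X * (F * F)) =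
      PowerSeries.X + F + PowerSeries.C (2 : ℂ) * (PowerSeries.X * F) +
        PowerSeries.X * PowerSeries.X * (F * (F * F)) := by
    have n2 : PowerSeries.C (2 : ℂ) = 2 := map_ofNat PowerSeries.C 2
    rw [n2, hF]
    linear_combination (PowerSeries.X * (T + 1) ^ 3 - (T + 2)) * hT
  rw [key] at hL
  have := hL.2.symm.trans hR.2
  linear_combination this
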